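/- Let G be a finite simple graph in which every vertex has degree at least 3 and which contains no gamma configuration. Suppose G contains the path configuration and that |N(w2) ∩ P| ≤ 2. Then for every integer k ≥ 1, G has a feedback vertex set of size at most k if and only if G − w1 has a feedback vertex set of size at most k − 1. (Correctness of Rule 15, stated for simple graphs.) -/

import Mathlib

/-- A set `S` is a feedback vertex set of `G` if the subgraph induced on the
complement of `S` is acyclic. `HasFVS G k` means `G` has a feedback vertex set
of size at most `k`. -/
def HasFVS {V : Type*} (G : SimpleGraph V) (k : ℕ) : Prop :=
  ∃ S : Set V, S.ncard ≤ k ∧ (G.induce Sᶜ).IsAcyclic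

/-- `ReachIn G W p q`: in the subgraph of `G` induced on `W`, vertex `p` can reach `q`
(in particular both lie in `W`). -/
def ReachIn {V : Type*} (G : SimpleGraph V) (W : Set V) (p q : V) : Prop :=
  ∃ (hp : p ∈ W) (hq : q ∈ W), (G.induce W).Reachable ⟨p, hp⟩ ⟨q, hq⟩

/-- A gamma configuration in `G`: distinct vertices `u, v, w, x` such that `u` has
exactly the three neighbors `v, w, x` and `v` is adjacent to both `w` and `x`. -/
def HasGammaConfig {V : Type*} (G : SimpleGraph V) : Prop :=
  ∃ u v w x : V, u ≠ v ∧ u ≠ w ∧ u ≠ x ∧ v ≠ w ∧ v ≠ x ∧ w ≠ x ∧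
    G.neighborSet u = {v, w, x} ∧ G.Adj v w ∧ G.Adj v x

/-- The path configuration: `u0, u, x1, x2, x3, v, v0` form an induced path in this
order, `w1, w2` are two further distinct vertices not among these seven, every
neighbor of a vertex of `P = {u, x1, x2, x3, v}` lying outside `P` belongs to
`{u0, v0, w1, w2}`, and each of `w1, w2` has at least one neighbor in `P`. -/
structure PathConfig {V : Type*} (G : SimpleGraph V)
    (u0 u x1 x2 x3 v v0 w1 w2 : V) : Prop where
  nodup : [u0, u, x1, x2, x3, v, v0, w1, w2].Nodup
  adj1 : G.Adj u0 u
  adj2 : G.Adj u x1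
  adj3 : G.Adj x1 x2
  adj4 : G.Adj x2 x3
  adj5 : G.Adj x3 v
  adj6 : G.Adj v v0
  na1 : ¬ G.Adj u0 x1
  na2 : ¬ G.Adj u0 x2
  na3 : ¬ G.Adj u0 x3
  na4 : ¬ G.Adj u0 v
  na5 : ¬ G.Adj u0 v0
  na6 : ¬ G.Adj u x2
  na7 : ¬ G.Adj u x3
  na8 : ¬ G.Adj u v
  na9 : ¬ G.Adj u v0
  na10 : ¬ G.Adj x1 x3
  na11 : ¬ G.Adj x1 v
  na12 : ¬ G.Adj x1 v0
  na13 : ¬ G.Adj x2 v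
  na14 : ¬ G.Adj x2 v0
  na15 : ¬ G.Adj x3 v0
  closed : ∀ p ∈ ({u, x1, x2, x3, v} : Set V), ∀ y : V, G.Adj p y →
    y ∉ ({u, x1, x2, x3, v} : Set V) → y ∈ ({u0, v0, w1, w2} : Set V)
  w1nb : ∃ p ∈ ({u, x1, x2, x3, v} : Set V), G.Adj w1 p
  w2nb : ∃ p ∈ ({u, x1, x2, x3, v} : Set V), G.Adj w2 p

section ForestLemmas

variable {V : Type*} {G : SimpleGraph V} {W X : Set V} {a b c p q w x y : V}

theorem isAcyclic_induce_iff :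
    (G.induce W).IsAcyclic ↔ ∀ (v : V) (c : G.Walk v v), c.IsCycle → ∃ x ∈ c.support, x ∉ W := by
  constructor
  · intro h v c hc
    by_contra! hW
    refine h (c.induce W hW) ?_
    rw [← SimpleGraph.Walk.isCycle_map_iff_of_injective (f := (SimpleGraph.Embedding.induce W).toHom)
      Subtype.val_injective]
    rwa [SimpleGraph.Walk.map_induce]
  · intro h v c hc
    obtain ⟨x, hx, hxW⟩ := h _ (c.map (SimpleGraph.Embedding.induce W).toHom)
      (hc.map Subtype.val_injective)
    simp only [SimpleGraph.Walk.support_map, List.mem_map] at hx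
    obtain ⟨y, -, rfl⟩ := hx
    exact hxW y.2

theorem isAcyclic_induce_mono (h : (G.induce W).IsAcyclic) (hX : X ⊆ W) :
    (G.induce X).IsAcyclic := by
  rw [isAcyclic_induce_iff] at h ⊢
  intro v c hc
  obtain ⟨x, hx, hxW⟩ := h v c hc
  exact ⟨x, hx, fun h => hxW (hX h)⟩

theorem reachIn_iff_exists_walk :
    ReachIn G W a b ↔ ∃ p : G.Walk a b, ∀ x ∈ p.support, x ∈ W := by
  constructor
  · rintro ⟨ha, hb, ⟨p⟩⟩
    refine ⟨p.map (SimpleGraph.Embedding.induce W).toHom, fun x hx => ?_⟩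
    have hx : x ∈ (p.map (SimpleGraph.Embedding.induce W).toHom).support := hx
    rw [SimpleGraph.Walk.support_map, List.mem_map] at hx
    obtain ⟨y, -, rfl⟩ := hx
    exact y.2
  · rintro ⟨p, hp⟩
    exact ⟨_, _, ⟨p.induce W hp⟩⟩

namespace ReachIn

theorem refl (ha : a ∈ W) : ReachIn G W a a := ⟨ha, ha, .rfl⟩

theorem symm (h : ReachIn G W a b) : ReachIn G W b a :=
  let ⟨ha, hb, h⟩ := h
  ⟨hb, ha, h.symm⟩

theorem trans (h : ReachIn G W a b) (h' : ReachIn G W b c) : ReachIn G W a c :=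
  let ⟨ha, _, h⟩ := h
  let ⟨_, hc, h'⟩ := h'
  ⟨ha, hc, h.trans h'⟩

theorem of_adj (h : G.Adj a b) (ha : a ∈ W) (hb : b ∈ W) : ReachIn G W a b :=
  ⟨ha, hb, SimpleGraph.Adj.reachable (by simpa using h)⟩

theorem mono (h : ReachIn G W a b) (hX : W ⊆ X) : ReachIn G X a b := by
  rw [reachIn_iff_exists_walk] at h ⊢
  obtain ⟨p, hp⟩ := h
  exact ⟨p, fun x hx => hX (hp x hx)⟩

/-- If all neighbors in `W` of a new vertex `p` are equal to `y`, then whatever `p` reaches in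
`insert p W` is reached by `y` in `W`. -/
theorem of_insert (hy : ∀ z ∈ W, G.Adj p z → z = y)
    (h : ReachIn G (insert p W) p a) : a = p ∨ ReachIn G W y a := by
  rw [reachIn_iff_exists_walk] at h
  obtain ⟨q, hq⟩ := h
  suffices key : ∀ (s t : V) (q : G.Walk s t), (∀ x ∈ q.support, x ∈ insert p W) →
      (s = p ∨ ReachIn G W y s) → t = p ∨ ReachIn G W y t from key _ _ q hq (.inl rfl)
  intro s t q
  induction q with
  | nil => exact fun _ h => h
  | @cons s s' t hadj q ih =>
    intro hq hs
    have hs' : s' ∈ insert p W := hq _ (by simp)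
    refine ih (fun x hx => hq x (by simp [hx])) ?_
    rcases hs' with rfl | hs'
    · exact .inl rfl
    right
    rcases hs with rfl | hs
    · obtain rfl := hy _ hs' hadj
      exact .refl hs'
    · obtain ⟨hy', hsW, -⟩ := id hs
      exact hs.trans (.of_adj hadj hsW hs')

end ReachIn

theorem not_reachIn_of_isAcyclic_induce (h : (G.induce W).IsAcyclic) (hx : x ∈ W) (hab : a ≠ b)
    (ha : G.Adj x a) (hb : G.Adj x b) : ¬ ReachIn G (W \ {x}) a b := by
  classical
  rw [reachIn_iff_exists_walk]
  rintro ⟨q, hq⟩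
  rw [isAcyclic_induce_iff] at h
  have hq' : ∀ z ∈ q.bypass.support, z ∈ W \ {x} :=
    fun z hz => hq z (q.support_bypass_subset_support hz)
  have hxq : x ∉ q.bypass.support := fun hz => (hq' x hz).2 rfl
  obtain ⟨z, hz, hzW⟩ := h x (.cons ha (q.bypass.concat hb.symm)) <| by
    rw [SimpleGraph.Walk.cons_isCycle_iff]
    refine ⟨q.bypass_isPath.concat hxq _, ?_⟩
    rw [SimpleGraph.Walk.edges_concat, List.concat_eq_append, List.mem_append]
    rintro (h | h)
    · exact hxq (q.bypass.fst_mem_support_of_mem_edges h)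
    · simp only [List.mem_singleton, Sym2.eq_iff] at h
      grind
  apply hzW
  simp only [SimpleGraph.Walk.support_cons, SimpleGraph.Walk.support_concat,
    List.mem_cons, List.mem_append, List.not_mem_nil, or_false] at hz
  rcases hz with rfl | hz | rfl
  · exact hx
  · exact (hq' z hz).1
  · exact hx

theorem isAcyclic_induce_insert (h : (G.induce W).IsAcyclic)
    (hp : ∀ y ∈ W, ∀ z ∈ W, G.Adj p y → G.Adj p z → y ≠ z → ¬ ReachIn G W y z) :
    (G.induce (insert p W)).IsAcyclic := by
  classical
  rw [isAcyclic_induce_iff] at h ⊢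
  intro v c hc
  by_contra! hW
  by_cases hpc : p ∈ c.support
  · have hW' : ∀ x ∈ (c.rotate p hpc).support, x ∈ insert p W := fun x hx =>
      hW x ((SimpleGraph.Walk.mem_support_rotate_iff ..).1 hx)
    have hc' := hc.rotate hpc
    generalize c.rotate p hpc = d at hW' hc'
    cases d with
    | nil => exact hc'.ne_nil rfl
    | @cons _ y _ hy q =>
      rw [SimpleGraph.Walk.cons_isCycle_iff] at hc'
      obtain ⟨hq, hedge⟩ := hc'
      cases hqr : q.reverse with
      | nil => exact hy.ne rfl
      | @cons _ z _ hz r =>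
        have hpath := hq.reverse
        rw [hqr, SimpleGraph.Walk.cons_isPath_iff] at hpath
        have hr : ∀ x ∈ r.support, x ∈ W := by
          intro x hx
          have hxq : x ∈ q.support := by
            rw [← List.mem_reverse, ← SimpleGraph.Walk.support_reverse, hqr]
            simp [hx]
          rcases hW' x (by simp [hxq]) with rfl | hx'
          · exact absurd hx hpath.2
          · exact hx'
        refine hp z (hr _ r.start_mem_support) y (hr _ r.end_mem_support) hz hy ?_
          (reachIn_iff_exists_walk.2 ⟨r, hr⟩)
        rintro rfl
        apply hedge
        rw [← List.mem_reverse, ← SimpleGraph.Walk.edges_reverse, hqr]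
        simp
  · obtain ⟨x, hx, hxW⟩ := h v c hc
    rcases hW x hx with rfl | hx'
    · exact hpc hx
    · exact hxW hx'

/-- Attaching to an induced forest a vertex `p` whose only neighbors are `y` and possibly `w`
(the latter only if `C` holds). -/
theorem isAcyclic_induce_insert_of_adj {C : Prop} (h : (G.induce W).IsAcyclic)
    (hp : ∀ z ∈ W, G.Adj p z → z = y ∨ (z = w ∧ C)) (hyw : C → ¬ ReachIn G W y w) :
    (G.induce (insert p W)).IsAcyclic := by
  refine isAcyclic_induce_insert h fun s hs t ht hps hpt hst hr => ?_
  rcases hp s hs hps with rfl | ⟨rfl, hC⟩ <;> rcases hp t ht hpt with rfl | ⟨rfl, hC'⟩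
  · exact hst rfl
  · exact hyw hC' hr
  · exact hyw hC hr.symm
  · exact hst rfl

theorem not_reachIn_insert {C : Prop}
    (hp : ∀ z ∈ W, G.Adj p z → z = y ∨ (z = w ∧ C)) (hC : ¬ C) (hpw : w ≠ p)
    (hyw : ¬ ReachIn G W y w) : ¬ ReachIn G (insert p W) p w := by
  intro h
  rcases ReachIn.of_insert (y := y) (fun z hz hpz => by grind) h with h | h
  · exact hpw h
  · exact hyw h

theorem hasFVS_induce_compl_singleton_iff [Finite V] {k : ℕ} (hk : 1 ≤ k) :
    HasFVS (G.induce ({w}ᶜ : Set V)) (k - 1) ↔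
      ∃ S : Set V, w ∈ S ∧ S.ncard ≤ k ∧ (G.induce Sᶜ).IsAcyclic := by
  constructor
  · rintro ⟨T, hT, hacyc⟩
    refine ⟨insert w (Subtype.val '' T), by simp, ?_, ?_⟩
    · have := Set.ncard_insert_le w (Subtype.val '' T)
      rw [Set.ncard_image_of_injective _ Subtype.val_injective] at this
      omega
    · refine hacyc.comap (G' := (G.induce ({w}ᶜ : Set V)).induce Tᶜ)
        ⟨fun x => ⟨⟨x.1, fun h => x.2 (.inl h)⟩, fun h => x.2 (.inr ⟨_, h, rfl⟩)⟩,
          fun {a b} h => by simpa using h⟩ ?_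
      intro a b hab
      exact Subtype.ext (congrArg (fun z => z.1.1) hab)
  · rintro ⟨S, hw, hS, hacyc⟩
    refine ⟨Subtype.val ⁻¹' S, ?_, ?_⟩
    · rw [← Set.ncard_image_of_injective _ Subtype.val_injective, Subtype.image_preimage_coe,
        Set.inter_comm, ← Set.sdiff_eq, Set.ncard_sdiff_singleton_of_mem hw]
      omega
    · refine hacyc.comap (G' := G.induce Sᶜ)
        ⟨fun x => ⟨x.1.1, x.2⟩, fun {a b} h => by simpa using h⟩ ?_
      intro a b hab
      exact Subtype.ext (Subtype.ext (congrArg (fun z : ↥Sᶜ => z.1) hab))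

end ForestLemmas

namespace PathConfig

variable {V : Type*} {G : SimpleGraph V} {u0 u x1 x2 x3 v v0 w1 w2 : V} {F W : Set V}

theorem reverse (h : PathConfig G u0 u x1 x2 x3 v v0 w1 w2) :
    PathConfig G v0 v x3 x2 x1 u u0 w1 w2 where
  nodup := by have := h.nodup; simp only [List.nodup_cons, List.mem_cons, not_or] at this ⊢; grind
  adj1 := h.adj6.symm
  adj2 := h.adj5.symm
  adj3 := h.adj4.symm
  adj4 := h.adj3.symm
  adj5 := h.adj2.symm
  adj6 := h.adj1.symm
  na1 := fun e => h.na15 e.symm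
  na2 := fun e => h.na14 e.symm
  na3 := fun e => h.na12 e.symm
  na4 := fun e => h.na9 e.symm
  na5 := fun e => h.na5 e.symm
  na6 := fun e => h.na13 e.symm
  na7 := fun e => h.na11 e.symm
  na8 := fun e => h.na8 e.symm
  na9 := fun e => h.na4 e.symm
  na10 := fun e => h.na10 e.symm
  na11 := fun e => h.na7 e.symm
  na12 := fun e => h.na3 e.symm
  na13 := fun e => h.na6 e.symm
  na14 := fun e => h.na2 e.symm
  na15 := fun e => h.na1 e.symm
  closed := by
    have := h.closed
    simp only [Set.mem_insert_iff, Set.mem_singleton_iff] at this ⊢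
    grind
  w1nb := by
    have := h.w1nb
    simp only [Set.mem_insert_iff, Set.mem_singleton_iff] at this ⊢
    grind
  w2nb := by
    have := h.w2nb
    simp only [Set.mem_insert_iff, Set.mem_singleton_iff] at this ⊢
    grind

theorem adj_left (h : PathConfig G u0 u x1 x2 x3 v v0 w1 w2) {z : V} (hz : G.Adj u z) :
    z = u0 ∨ z = x1 ∨ z = w1 ∨ z = w2 := by
  have h1 := or_iff_not_imp_left.2 (h.closed u (by simp) z hz)
  simp only [Set.mem_insert_iff, Set.mem_singleton_iff] at h1
  have := hz.ne
  grind [h.na6, h.na7, h.na8, h.na9]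

theorem adj_second (h : PathConfig G u0 u x1 x2 x3 v v0 w1 w2) {z : V} (hz : G.Adj x1 z) :
    z = u ∨ z = x2 ∨ z = w1 ∨ z = w2 := by
  have h1 := or_iff_not_imp_left.2 (h.closed x1 (by simp) z hz)
  simp only [Set.mem_insert_iff, Set.mem_singleton_iff] at h1
  have := hz.ne
  have := hz.symm
  grind [h.na1, h.na10, h.na11, h.na12]

theorem adj_middle (h : PathConfig G u0 u x1 x2 x3 v v0 w1 w2) {z : V} (hz : G.Adj x2 z) :
    z = x1 ∨ z = x3 ∨ z = w1 ∨ z = w2 := by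
  have h1 := or_iff_not_imp_left.2 (h.closed x2 (by simp) z hz)
  simp only [Set.mem_insert_iff, Set.mem_singleton_iff] at h1
  have := hz.ne
  have := hz.symm
  grind [h.na2, h.na6, h.na13, h.na14]

/-- A vertex all of whose neighbors lie in `{a, b, w1, w2}` is adjacent to `w1` or `w2`
if it has degree at least three. -/
theorem adj_or_adj_of_degree {a b p : V} (hdeg : 3 ≤ (G.neighborSet p).ncard)
    (hp : ∀ z, G.Adj p z → z = a ∨ z = b ∨ z = w1 ∨ z = w2) : G.Adj w1 p ∨ G.Adj w2 p := by
  by_contra! hn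
  have hsub : G.neighborSet p ⊆ {a, b} := by
    intro z hz
    have := (show G.Adj p z from hz).symm
    have := hp z hz
    simp only [Set.mem_insert_iff, Set.mem_singleton_iff]
    grind
  have := Set.ncard_le_ncard hsub
  have := Set.ncard_insert_le a {b}
  rw [Set.ncard_singleton] at this
  omega

theorem adj_or_adj (h : PathConfig G u0 u x1 x2 x3 v v0 w1 w2)
    (hdeg : ∀ z : V, 3 ≤ (G.neighborSet z).ncard) :
    (G.Adj w1 u ∨ G.Adj w2 u) ∧ (G.Adj w1 x1 ∨ G.Adj w2 x1) ∧ (G.Adj w1 x2 ∨ G.Adj w2 x2) ∧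
      (G.Adj w1 x3 ∨ G.Adj w2 x3) ∧ (G.Adj w1 v ∨ G.Adj w2 v) :=
  ⟨adj_or_adj_of_degree (hdeg _) fun _ => h.adj_left,
    adj_or_adj_of_degree (hdeg _) fun _ => h.adj_second,
    adj_or_adj_of_degree (hdeg _) fun _ => h.adj_middle,
    adj_or_adj_of_degree (hdeg _) fun _ => h.reverse.adj_second,
    adj_or_adj_of_degree (hdeg _) fun _ => h.reverse.adj_left⟩

theorem not_three_adj {P : Set V} [Finite V] (hw : (G.neighborSet w2 ∩ P).ncard ≤ 2) {a b c : V}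
    (ha : a ∈ P) (hb : b ∈ P) (hc : c ∈ P) (hab : a ≠ b) (hac : a ≠ c) (hbc : b ≠ c) :
    ¬ (G.Adj w2 a ∧ G.Adj w2 b ∧ G.Adj w2 c) := by
  rintro ⟨h1, h2, h3⟩
  have hsub : ({a, b, c} : Set V) ⊆ G.neighborSet w2 ∩ P := by
    rintro z (rfl | rfl | rfl)
    exacts [⟨h1, ha⟩, ⟨h2, hb⟩, ⟨h3, hc⟩]
  have := Set.ncard_le_ncard hsub (Set.toFinite _)
  rw [Set.ncard_eq_three.2 ⟨a, b, c, hab, hac, hbc, rfl⟩] at this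
  omega

/-- A forest `F` missing the path and `w1` extends to the path minus one vertex, provided
`u0` and `w2` are not connected in `F`. -/
theorem exists_isAcyclic_union (h : PathConfig G u0 u x1 x2 x3 v v0 w1 w2)
    (hw2 : ∀ a ∈ ({u, x1, x2, x3, v} : Set V), ∀ b ∈ ({u, x1, x2, x3, v} : Set V),
      ∀ c ∈ ({u, x1, x2, x3, v} : Set V), a ≠ b → a ≠ c → b ≠ c →
      ¬ (G.Adj w2 a ∧ G.Adj w2 b ∧ G.Adj w2 c))
    (hF : (G.induce F).IsAcyclic) (hw1F : w1 ∉ F)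
    (hPF : ∀ p ∈ ({u, x1, x2, x3, v} : Set V), p ∉ F) (hr : ¬ ReachIn G F u0 w2) :
    ∃ t, (G.induce (F ∪ ({u, x1, x2, x3, v} \ {t}))).IsAcyclic := by
  have hd := h.nodup
  simp only [List.nodup_cons, List.mem_cons, not_or, List.not_mem_nil, not_false_eq_true,
    and_true, List.nodup_nil] at hd
  simp only [Set.mem_insert_iff, Set.mem_singleton_iff, forall_eq_or_imp, forall_eq] at hPF hw2
  obtain ⟨hu, hx1, hx2, hx3, hv⟩ := hPF
  have nu : ∀ z ∈ F, G.Adj u z → z = u0 ∨ (z = w2 ∧ G.Adj w2 u) := fun z hz hadj => by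
    have := h.adj_left hadj
    have := hadj.symm
    grind
  have nx1 : ∀ z ∈ insert u F, G.Adj x1 z → z = u ∨ (z = w2 ∧ G.Adj w2 x1) := fun z hz hadj => by
    have := h.adj_second hadj
    have := hadj.symm
    grind
  have nx2 : ∀ z ∈ insert x1 (insert u F), G.Adj x2 z → z = x1 ∨ (z = w2 ∧ G.Adj w2 x2) :=
    fun z hz hadj => by
      have := h.adj_middle hadj
      have := hadj.symm
      grind
  have nx3 : ∀ z ∈ insert x2 (insert x1 (insert u F)), G.Adj x3 z →
      z = x2 ∨ (z = w2 ∧ G.Adj w2 x3) := fun z hz hadj => by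
    have := h.reverse.adj_second hadj
    have := hadj.symm
    grind
  have au := isAcyclic_induce_insert_of_adj hF nu (fun _ => hr)
  have ru : ¬ G.Adj w2 u → _ := fun hn => not_reachIn_insert nu hn (by grind) hr
  have ax1 := fun hn => isAcyclic_induce_insert_of_adj au nx1 hn
  have rx1 : ¬ G.Adj w2 x1 → _ := fun hn hr => not_reachIn_insert nx1 hn (by grind) hr
  have ax2 := fun ha hn => isAcyclic_induce_insert_of_adj (ax1 ha) nx2 hn
  have rx2 : ¬ G.Adj w2 x2 → _ := fun hn hr => not_reachIn_insert nx2 hn (by grind) hr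
  have ax3 := fun ha hb hn => isAcyclic_induce_insert_of_adj (ax2 ha hb) nx3 hn
  by_cases bv : G.Adj w2 v
  · refine ⟨v, isAcyclic_induce_mono (ax3 ?_ ?_ ?_) ?_⟩
    · grind
    · grind
    · grind
    · intro z hz
      simp only [Set.mem_insert_iff, Set.mem_union, Set.mem_sdiff, Set.mem_singleton_iff] at hz ⊢
      grind
  have leaf : ∀ {X : Set V} {p y : V}, (G.induce X).IsAcyclic →
      (∀ z ∈ X, G.Adj p z → z = y) → (G.induce (insert p X)).IsAcyclic := fun hX hp =>
    isAcyclic_induce_insert_of_adj (C := False) (w := w2) hX (fun z hz hadj => .inl (hp z hz hadj))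
      (fun hC => hC.elim)
  have nv : ∀ z, G.Adj v z → z = v0 ∨ z = x3 ∨ z = w1 := fun z hadj => by
    have := h.reverse.adj_left hadj
    have := hadj.symm
    grind
  by_cases bx3 : G.Adj w2 x3
  · refine ⟨x3, isAcyclic_induce_mono (leaf (p := v) (y := v0) (ax2 ?_ ?_) ?_) ?_⟩
    · grind
    · grind
    · grind
    · intro z hz
      simp only [Set.mem_insert_iff, Set.mem_union, Set.mem_sdiff, Set.mem_singleton_iff] at hz ⊢
      grind
  have nx3' : ∀ z, G.Adj x3 z → z = v ∨ z = x2 ∨ z = w1 := fun z hadj => by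
    have := h.reverse.adj_second hadj
    have := hadj.symm
    grind
  by_cases bx2 : G.Adj w2 x2
  · refine ⟨x2, isAcyclic_induce_mono (leaf (p := x3) (y := v)
      (leaf (p := v) (y := v0) (ax1 ?_) ?_) ?_) ?_⟩
    · grind
    · grind
    · grind
    · intro z hz
      simp only [Set.mem_insert_iff, Set.mem_union, Set.mem_sdiff, Set.mem_singleton_iff] at hz ⊢
      grind
  have nx2' : ∀ z, G.Adj x2 z → z = x3 ∨ z = x1 ∨ z = w1 := fun z hadj => by
    have := h.adj_middle hadj
    have := hadj.symm
    grind
  refine ⟨x1, isAcyclic_induce_mono (leaf (p := x2) (y := x3) (leaf (p := x3) (y := v)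
    (leaf (p := v) (y := v0) au ?_) ?_) ?_) ?_⟩
  · grind
  · grind
  · grind
  · intro z hz
    simp only [Set.mem_insert_iff, Set.mem_union, Set.mem_sdiff, Set.mem_singleton_iff] at hz ⊢
    grind

/-- A forest `F` missing the path, `w1` and `w2` extends to the whole path, provided
`u0` and `v0` are not connected in `F`. -/
theorem isAcyclic_union (h : PathConfig G u0 u x1 x2 x3 v v0 w1 w2)
    (hF : (G.induce F).IsAcyclic) (hw1F : w1 ∉ F) (hw2F : w2 ∉ F)
    (hPF : ∀ p ∈ ({u, x1, x2, x3, v} : Set V), p ∉ F) (hr : ¬ ReachIn G F u0 v0) :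
    (G.induce (F ∪ {u, x1, x2, x3, v})).IsAcyclic := by
  have hd := h.nodup
  simp only [List.nodup_cons, List.mem_cons, not_or, List.not_mem_nil, not_false_eq_true,
    and_true, List.nodup_nil] at hd
  simp only [Set.mem_insert_iff, Set.mem_singleton_iff, forall_eq_or_imp, forall_eq] at hPF
  obtain ⟨hu, hx1, hx2, hx3, hv⟩ := hPF
  have nu : ∀ z ∈ F, G.Adj u z → z = u0 ∨ (z = v0 ∧ False) := fun z hz hadj => by
    have := h.adj_left hadj
    grind
  have nx1 : ∀ z ∈ insert u F, G.Adj x1 z → z = u ∨ (z = v0 ∧ False) := fun z hz hadj => by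
    have := h.adj_second hadj
    grind
  have nx2 : ∀ z ∈ insert x1 (insert u F), G.Adj x2 z → z = x1 ∨ (z = v0 ∧ False) :=
    fun z hz hadj => by
      have := h.adj_middle hadj
      grind
  have nx3 : ∀ z ∈ insert x2 (insert x1 (insert u F)), G.Adj x3 z →
      z = x2 ∨ (z = v0 ∧ False) := fun z hz hadj => by
    have := h.reverse.adj_second hadj
    grind
  have nv : ∀ z ∈ insert x3 (insert x2 (insert x1 (insert u F))), G.Adj v z →
      z = x3 ∨ (z = v0 ∧ True) := fun z hz hadj => by
    have := h.reverse.adj_left hadj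
    grind
  have ru := not_reachIn_insert nu id (by grind) hr
  have rx1 := not_reachIn_insert nx1 id (by grind) ru
  have rx2 := not_reachIn_insert nx2 id (by grind) rx1
  have rx3 := not_reachIn_insert nx3 id (by grind) rx2
  refine isAcyclic_induce_mono (isAcyclic_induce_insert_of_adj (isAcyclic_induce_insert_of_adj
    (isAcyclic_induce_insert_of_adj (isAcyclic_induce_insert_of_adj (isAcyclic_induce_insert_of_adj
      hF nu fun _ => hr) nx1 fun _ => ru) nx2 fun _ => rx1) nx3 fun _ => rx2) nv fun _ => rx3) ?_
  intro z hz
  simp only [Set.mem_insert_iff, Set.mem_union, Set.mem_singleton_iff] at hz ⊢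
  grind

end PathConfig

namespace PathConfig

variable {V : Type*} {G : SimpleGraph V} {u0 u x1 x2 x3 v v0 w1 w2 w : V} {W : Set V}

theorem reachIn_segments (h : PathConfig G u0 u x1 x2 x3 v v0 w1 w2) (X : Set V) :
    (u ∈ X → x1 ∈ X → ReachIn G X u x1) ∧ (x1 ∈ X → x2 ∈ X → ReachIn G X x1 x2) ∧
    (x2 ∈ X → x3 ∈ X → ReachIn G X x2 x3) ∧ (x3 ∈ X → v ∈ X → ReachIn G X x3 v) ∧
    (x1 ∈ X → x2 ∈ X → x3 ∈ X → ReachIn G X x1 x3) ∧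
    (x2 ∈ X → x3 ∈ X → v ∈ X → ReachIn G X x2 v) ∧
    (x1 ∈ X → x2 ∈ X → x3 ∈ X → v ∈ X → ReachIn G X x1 v) :=
  ⟨.of_adj h.adj2, .of_adj h.adj3, .of_adj h.adj4, .of_adj h.adj5,
    fun a b c => .trans (.of_adj h.adj3 a b) (.of_adj h.adj4 b c),
    fun a b c => .trans (.of_adj h.adj4 a b) (.of_adj h.adj5 b c),
    fun a b c d => .trans (.of_adj h.adj3 a b) (.trans (.of_adj h.adj4 b c) (.of_adj h.adj5 c d))⟩

/-- A vertex of a forest outside the path has at most one neighbor on each segment of the path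
contained in the forest. -/
theorem not_adj_and_adj (h : PathConfig G u0 u x1 x2 x3 v v0 w1 w2)
    (hW : (G.induce W).IsAcyclic) (hw : w ∈ W)
    (hwP : w ∉ ({u, x1, x2, x3, v} : Set V)) :
    (u ∈ W → x1 ∈ W → ¬ (G.Adj w u ∧ G.Adj w x1)) ∧
    (x1 ∈ W → x2 ∈ W → ¬ (G.Adj w x1 ∧ G.Adj w x2)) ∧
    (x2 ∈ W → x3 ∈ W → ¬ (G.Adj w x2 ∧ G.Adj w x3)) ∧
    (x3 ∈ W → v ∈ W → ¬ (G.Adj w x3 ∧ G.Adj w v)) ∧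
    (x1 ∈ W → x2 ∈ W → x3 ∈ W → ¬ (G.Adj w x1 ∧ G.Adj w x3)) ∧
    (x2 ∈ W → x3 ∈ W → v ∈ W → ¬ (G.Adj w x2 ∧ G.Adj w v)) ∧
    (x1 ∈ W → x2 ∈ W → x3 ∈ W → v ∈ W → ¬ (G.Adj w x1 ∧ G.Adj w v)) := by
  have hd := h.nodup
  simp only [List.nodup_cons, List.mem_cons, not_or, List.not_mem_nil, not_false_eq_true,
    and_true, List.nodup_nil] at hd
  simp only [Set.mem_insert_iff, Set.mem_singleton_iff] at hwP
  have hs := h.reachIn_segments (W \ {w})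
  simp only [Set.mem_sdiff, Set.mem_singleton_iff] at hs
  have key : ∀ {a b}, a ≠ b → ReachIn G (W \ {w}) a b → ¬ (G.Adj w a ∧ G.Adj w b) :=
    fun hab hr ⟨ha, hb⟩ => not_reachIn_of_isAcyclic_induce hW hw hab ha hb hr
  obtain ⟨h1, h2, h3, h4, h5, h6, h7⟩ := hs
  refine ⟨fun a b => key ?_ (h1 ?_ ?_), fun a b => key ?_ (h2 ?_ ?_), fun a b => key ?_ (h3 ?_ ?_),
    fun a b => key ?_ (h4 ?_ ?_), fun a b c => key ?_ (h5 ?_ ?_ ?_),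
    fun a b c => key ?_ (h6 ?_ ?_ ?_), fun a b c d => key ?_ (h7 ?_ ?_ ?_ ?_)⟩ <;> grind

/-- If a forest contains `w1` and all but at most two vertices of the path, then `w2` is not
connected outside the path to both ends `u0` and `v0`. -/
theorem not_reachIn_or_not_reachIn (h : PathConfig G u0 u x1 x2 x3 v v0 w1 w2)
    (hA : (G.Adj w1 u ∨ G.Adj w2 u) ∧ (G.Adj w1 x1 ∨ G.Adj w2 x1) ∧ (G.Adj w1 x2 ∨ G.Adj w2 x2) ∧
      (G.Adj w1 x3 ∨ G.Adj w2 x3) ∧ (G.Adj w1 v ∨ G.Adj w2 v))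
    (hW : (G.induce W).IsAcyclic) (hw1 : w1 ∈ W) {s t : V}
    (hst : ∀ p ∈ ({u, x1, x2, x3, v} : Set V), p ∈ W ∨ p = s ∨ p = t) :
    ¬ ReachIn G (W \ insert w1 {u, x1, x2, x3, v}) u0 w2 ∨
      ¬ ReachIn G (W \ insert w1 {u, x1, x2, x3, v}) v0 w2 := by
  have hd := h.nodup
  simp only [List.nodup_cons, List.mem_cons, not_or, List.not_mem_nil, not_false_eq_true,
    and_true, List.nodup_nil] at hd
  simp only [Set.mem_insert_iff, Set.mem_singleton_iff, forall_eq_or_imp, forall_eq] at hst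
  by_contra! hcon
  set F := W \ insert w1 {u, x1, x2, x3, v} with hFdef
  obtain ⟨hr, hr'⟩ := hcon
  have hu0 : u0 ∈ W := hr.1.1
  have hv0 : v0 ∈ W := hr'.1.1
  have hw2 : w2 ∈ W := hr.2.1.1
  have hF : ∀ {y}, y ∈ insert w1 ({u, x1, x2, x3, v} : Set V) → F ⊆ W \ {y} :=
    fun hy z hz => ⟨hz.1, fun hzy => hz.2 (hzy ▸ hy)⟩
  obtain ⟨p1, p2, p3, p4, p5, p6, p7⟩ := h.not_adj_and_adj hW hw1 (by simp; grind)
  obtain ⟨q1, q2, q3, q4, q5, q6, q7⟩ := h.not_adj_and_adj hW hw2 (by simp; grind)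
  have mem : ∀ {x y}, x ∈ W → x ≠ y → x ∈ W \ {y} := fun h1 h2 => ⟨h1, h2⟩
  have bu : u ∈ W → ¬ G.Adj w2 u := fun hu e =>
    not_reachIn_of_isAcyclic_induce hW hu (by grind) h.adj1.symm e.symm (hr.mono (hF (by simp)))
  have bv : v ∈ W → ¬ G.Adj w2 v := fun hv e =>
    not_reachIn_of_isAcyclic_induce hW hv (by grind) h.adj6 e.symm (hr'.mono (hF (by simp)))
  have hux1 : u ∈ W → x1 ∈ W → G.Adj w2 x1 → False := fun hu hx e =>
    not_reachIn_of_isAcyclic_induce hW hu (by grind) h.adj1.symm h.adj2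
      ((hr.mono (hF (by simp))).trans (.of_adj e (mem hw2 (by grind)) (mem hx (by grind))))
  have hvx3 : v ∈ W → x3 ∈ W → G.Adj w2 x3 → False := fun hv hx e =>
    not_reachIn_of_isAcyclic_induce hW hv (by grind) h.adj6 h.adj5.symm
      ((hr'.mono (hF (by simp))).trans (.of_adj e (mem hw2 (by grind)) (mem hx (by grind))))
  have ru : u ∈ W → ReachIn G (W \ {w1}) u w2 := fun hu =>
    .trans (.of_adj h.adj1.symm (mem hu (by grind)) (mem hu0 (by grind))) (hr.mono (hF (by simp)))
  have rv : v ∈ W → ReachIn G (W \ {w1}) v w2 := fun hv =>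
    .trans (.of_adj h.adj6 (mem hv (by grind)) (mem hv0 (by grind))) (hr'.mono (hF (by simp)))
  have rb : ∀ {x}, x ∈ W → G.Adj w2 x → x ≠ w1 → ReachIn G (W \ {w1}) x w2 := fun hx e hne =>
    .of_adj e.symm (mem hx hne) (mem hw2 (by grind))
  have rx1 : x1 ∈ W → G.Adj w2 x1 → ReachIn G (W \ {w1}) x1 w2 := fun hx e => rb hx e (by grind)
  have rx2 : x2 ∈ W → G.Adj w2 x2 → ReachIn G (W \ {w1}) x2 w2 := fun hx e => rb hx e (by grind)
  have rx3 : x3 ∈ W → G.Adj w2 x3 → ReachIn G (W \ {w1}) x3 w2 := fun hx e => rb hx e (by grind)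
  obtain ⟨s1, s2, s3, s4, -⟩ := h.reachIn_segments (W \ {w1})
  have r12 : x1 ∈ W → x2 ∈ W → ReachIn G (W \ {w1}) x1 x2 := fun a b =>
    s2 (mem a (by grind)) (mem b (by grind))
  have r23 : x2 ∈ W → x3 ∈ W → ReachIn G (W \ {w1}) x2 x3 := fun a b =>
    s3 (mem a (by grind)) (mem b (by grind))
  have fin : ∀ {a b}, a ≠ b → G.Adj w1 a → G.Adj w1 b → ReachIn G (W \ {w1}) a w2 →
      ReachIn G (W \ {w1}) b w2 → False := fun hab ha hb h1 h2 =>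
    not_reachIn_of_isAcyclic_induce hW hw1 hab ha hb (h1.trans h2.symm)
  have hxu : u ∉ W ∨ x1 ∉ W := by grind
  have hxv : v ∉ W ∨ x3 ∉ W := by grind
  obtain hxu | hxu := hxu <;> obtain hxv | hxv := hxv
  · grind
  · have hx1 : x1 ∈ W := by grind
    have hx2 : x2 ∈ W := by grind
    have hv : v ∈ W := by grind
    have hvA : G.Adj w1 v := by grind
    by_cases e : G.Adj w2 x1
    · exact fin (a := x2) (b := v) (by grind) (by grind) hvA
        ((r12 hx1 hx2).symm.trans (rx1 hx1 e)) (rv hv)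
    · exact fin (a := x1) (b := v) (by grind) (by grind) hvA
        ((r12 hx1 hx2).trans (rx2 hx2 (by grind))) (rv hv)
  · have hx3 : x3 ∈ W := by grind
    have hx2 : x2 ∈ W := by grind
    have hu : u ∈ W := by grind
    have huA : G.Adj w1 u := by grind
    by_cases e : G.Adj w2 x3
    · exact fin (a := x2) (b := u) (by grind) (by grind) huA
        ((r23 hx2 hx3).trans (rx3 hx3 e)) (ru hu)
    · exact fin (a := x3) (b := u) (by grind) (by grind) huA
        ((r23 hx2 hx3).symm.trans (rx2 hx2 (by grind))) (ru hu)
  · have hv : v ∈ W := by grind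
    have hu : u ∈ W := by grind
    exact fin (a := u) (b := v) (by grind) (by grind) (by grind) (ru hu) (rv hv)

/-- A forest containing `w1` misses one of the last four vertices of the path. -/
theorem not_mem_of_isAcyclic (h : PathConfig G u0 u x1 x2 x3 v v0 w1 w2)
    (hA : (G.Adj w1 u ∨ G.Adj w2 u) ∧ (G.Adj w1 x1 ∨ G.Adj w2 x1) ∧ (G.Adj w1 x2 ∨ G.Adj w2 x2) ∧
      (G.Adj w1 x3 ∨ G.Adj w2 x3) ∧ (G.Adj w1 v ∨ G.Adj w2 v))
    (hB : ∀ a ∈ ({u, x1, x2, x3, v} : Set V), ∀ b ∈ ({u, x1, x2, x3, v} : Set V),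
      ∀ c ∈ ({u, x1, x2, x3, v} : Set V), a ≠ b → a ≠ c → b ≠ c →
      ¬ (G.Adj w2 a ∧ G.Adj w2 b ∧ G.Adj w2 c))
    (hW : (G.induce W).IsAcyclic) (hw1 : w1 ∈ W) :
    ¬ (x1 ∈ W ∧ x2 ∈ W ∧ x3 ∈ W ∧ v ∈ W) := by
  have hd := h.nodup
  simp only [List.nodup_cons, List.mem_cons, not_or, List.not_mem_nil, not_false_eq_true,
    and_true, List.nodup_nil] at hd
  have hp := h.not_adj_and_adj hW hw1 (by simp; grind)
  have b1 := hB x1 (by simp) x2 (by simp) x3 (by simp)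
  have b2 := hB x1 (by simp) x2 (by simp) v (by simp)
  have b3 := hB x1 (by simp) x3 (by simp) v (by simp)
  have b4 := hB x2 (by simp) x3 (by simp) v (by simp)
  grind

theorem not_mem_and_not_reachIn_of_second (h : PathConfig G u0 u x1 x2 x3 v v0 w1 w2)
    (hA : (G.Adj w1 u ∨ G.Adj w2 u) ∧ (G.Adj w1 x1 ∨ G.Adj w2 x1) ∧ (G.Adj w1 x2 ∨ G.Adj w2 x2) ∧
      (G.Adj w1 x3 ∨ G.Adj w2 x3) ∧ (G.Adj w1 v ∨ G.Adj w2 v))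
    (hB : ∀ a ∈ ({u, x1, x2, x3, v} : Set V), ∀ b ∈ ({u, x1, x2, x3, v} : Set V),
      ∀ c ∈ ({u, x1, x2, x3, v} : Set V), a ≠ b → a ≠ c → b ≠ c →
      ¬ (G.Adj w2 a ∧ G.Adj w2 b ∧ G.Adj w2 c))
    (hW : (G.induce W).IsAcyclic) (hw1 : w1 ∈ W) (hu : u ∈ W) (hx2 : x2 ∈ W) (hx3 : x3 ∈ W)
    (hv : v ∈ W) :
    w2 ∉ W ∧ ¬ ReachIn G (W \ insert w1 {u, x1, x2, x3, v}) u0 v0 := by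
  have hd := h.nodup
  simp only [List.nodup_cons, List.mem_cons, not_or, List.not_mem_nil, not_false_eq_true,
    and_true, List.nodup_nil] at hd
  have hp := h.not_adj_and_adj hW hw1 (by simp; grind)
  have b1 := hB u (by simp) x2 (by simp) x3 (by simp)
  have b2 := hB u (by simp) x2 (by simp) v (by simp)
  have b3 := hB u (by simp) x3 (by simp) v (by simp)
  have b4 := hB x2 (by simp) x3 (by simp) v (by simp)
  have hA' : G.Adj w1 u ∧ (G.Adj w1 x2 ∨ G.Adj w1 x3 ∨ G.Adj w1 v) := by grind
  refine ⟨fun hw2 => ?_, fun hr => ?_⟩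
  · have hq := h.not_adj_and_adj hW hw2 (by simp; grind)
    grind
  have mem : ∀ {x}, x ∈ W → x ≠ w1 → x ∈ W \ {w1} := fun h1 h2 => ⟨h1, h2⟩
  have mu0 := mem hr.1.1 (by grind)
  have mv0 := mem hr.2.1.1 (by grind)
  have mv := mem hv (by grind)
  have mx3 := mem hx3 (by grind)
  have r : ReachIn G (W \ {w1}) u v :=
    ((ReachIn.of_adj h.adj1.symm (mem hu (by grind)) mu0).trans (hr.mono
      fun z hz => ⟨hz.1, fun e => hz.2 (.inl e)⟩)).trans (.of_adj h.adj6.symm mv0 mv)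
  have r3 := r.trans (.of_adj h.adj5.symm mv mx3)
  have r2 := r3.trans (.of_adj h.adj4.symm mx3 (mem hx2 (by grind)))
  obtain ⟨hAu, e | e | e⟩ := hA'
  · exact not_reachIn_of_isAcyclic_induce hW hw1 (by grind) hAu e r2
  · exact not_reachIn_of_isAcyclic_induce hW hw1 (by grind) hAu e r3
  · exact not_reachIn_of_isAcyclic_induce hW hw1 (by grind) hAu e r

theorem not_mem_and_not_reachIn_of_middle (h : PathConfig G u0 u x1 x2 x3 v v0 w1 w2)
    (hA : (G.Adj w1 u ∨ G.Adj w2 u) ∧ (G.Adj w1 x1 ∨ G.Adj w2 x1) ∧ (G.Adj w1 x2 ∨ G.Adj w2 x2) ∧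
      (G.Adj w1 x3 ∨ G.Adj w2 x3) ∧ (G.Adj w1 v ∨ G.Adj w2 v))
    (hB : ∀ a ∈ ({u, x1, x2, x3, v} : Set V), ∀ b ∈ ({u, x1, x2, x3, v} : Set V),
      ∀ c ∈ ({u, x1, x2, x3, v} : Set V), a ≠ b → a ≠ c → b ≠ c →
      ¬ (G.Adj w2 a ∧ G.Adj w2 b ∧ G.Adj w2 c))
    (hW : (G.induce W).IsAcyclic) (hw1 : w1 ∈ W) (hu : u ∈ W) (hx1 : x1 ∈ W) (hx3 : x3 ∈ W)
    (hv : v ∈ W) :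
    w2 ∉ W ∧ ¬ ReachIn G (W \ insert w1 {u, x1, x2, x3, v}) u0 v0 := by
  have hd := h.nodup
  simp only [List.nodup_cons, List.mem_cons, not_or, List.not_mem_nil, not_false_eq_true,
    and_true, List.nodup_nil] at hd
  have hp := h.not_adj_and_adj hW hw1 (by simp; grind)
  have b1 := hB u (by simp) x1 (by simp) x3 (by simp)
  have b2 := hB u (by simp) x1 (by simp) v (by simp)
  have b3 := hB u (by simp) x3 (by simp) v (by simp)
  have b4 := hB x1 (by simp) x3 (by simp) v (by simp)
  have hAu : (G.Adj w1 u ∧ G.Adj w2 x1) ∨ (G.Adj w1 x1 ∧ G.Adj w2 u) := by grind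
  have hAv : (G.Adj w1 v ∧ G.Adj w2 x3) ∨ (G.Adj w1 x3 ∧ G.Adj w2 v) := by grind
  have mem : ∀ {x}, x ∈ W → x ≠ w1 → x ∈ W \ {w1} := fun h1 h2 => ⟨h1, h2⟩
  have mu := mem hu (by grind)
  have mx1 := mem hx1 (by grind)
  have mx3 := mem hx3 (by grind)
  have mv := mem hv (by grind)
  have ru := ReachIn.of_adj h.adj2 mu mx1
  have rv := ReachIn.of_adj h.adj5 mx3 mv
  -- joining a vertex of the first segment to one of the second closes a cycle through `w1`
  have main : ReachIn G (W \ {w1}) u v → False := by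
    intro r
    rcases hAu with ⟨e, -⟩ | ⟨e, -⟩ <;> rcases hAv with ⟨e', -⟩ | ⟨e', -⟩
    · exact not_reachIn_of_isAcyclic_induce hW hw1 (by grind) e e' r
    · exact not_reachIn_of_isAcyclic_induce hW hw1 (by grind) e e' (r.trans rv.symm)
    · exact not_reachIn_of_isAcyclic_induce hW hw1 (by grind) e e' (ru.symm.trans r)
    · exact not_reachIn_of_isAcyclic_induce hW hw1 (by grind) e e'
        (ru.symm.trans (r.trans rv.symm))
  refine ⟨fun hw2 => main ?_, fun hr => main ?_⟩
  · have mw2 := mem hw2 (by grind)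
    have r1 : ReachIn G (W \ {w1}) u w2 := by
      rcases hAu with ⟨-, e⟩ | ⟨-, e⟩
      · exact ru.trans (.of_adj e.symm mx1 mw2)
      · exact .of_adj e.symm mu mw2
    rcases hAv with ⟨-, e⟩ | ⟨-, e⟩
    · exact r1.trans ((ReachIn.of_adj e mw2 mx3).trans rv)
    · exact r1.trans (.of_adj e mw2 mv)
  · exact ((ReachIn.of_adj h.adj1.symm mu (mem hr.1.1 (by grind))).trans (hr.mono
      fun z hz => ⟨hz.1, fun e => hz.2 (.inl e)⟩)).trans
        (.of_adj h.adj6.symm (mem hr.2.1.1 (by grind)) mv)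

end PathConfig

namespace PathConfig

variable {V : Type*} [Finite V] {G : SimpleGraph V} {u0 u x1 x2 x3 v v0 w1 w2 : V} {S : Set V}

/-- In a feedback vertex set avoiding `w1`, the vertices on the path can be exchanged for `w1`
and a smaller set `T`. -/
theorem exists_isAcyclic_exchange (h : PathConfig G u0 u x1 x2 x3 v v0 w1 w2)
    (hA : (G.Adj w1 u ∨ G.Adj w2 u) ∧ (G.Adj w1 x1 ∨ G.Adj w2 x1) ∧ (G.Adj w1 x2 ∨ G.Adj w2 x2) ∧
      (G.Adj w1 x3 ∨ G.Adj w2 x3) ∧ (G.Adj w1 v ∨ G.Adj w2 v))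
    (hB : ∀ a ∈ ({u, x1, x2, x3, v} : Set V), ∀ b ∈ ({u, x1, x2, x3, v} : Set V),
      ∀ c ∈ ({u, x1, x2, x3, v} : Set V), a ≠ b → a ≠ c → b ≠ c →
      ¬ (G.Adj w2 a ∧ G.Adj w2 b ∧ G.Adj w2 c))
    (hS : (G.induce Sᶜ).IsAcyclic) (hw1 : w1 ∉ S) :
    ∃ T : Set V, T.ncard + 1 ≤ (S ∩ {u, x1, x2, x3, v}).ncard ∧
      (G.induce (insert w1 (S \ {u, x1, x2, x3, v} ∪ T))ᶜ).IsAcyclic := by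
  have hrev : ({v, x3, x2, x1, u} : Set V) = {u, x1, x2, x3, v} := by
    ext z
    simp only [Set.mem_insert_iff, Set.mem_singleton_iff]
    grind
  have hA' : (G.Adj w1 v ∨ G.Adj w2 v) ∧ (G.Adj w1 x3 ∨ G.Adj w2 x3) ∧
      (G.Adj w1 x2 ∨ G.Adj w2 x2) ∧ (G.Adj w1 x1 ∨ G.Adj w2 x1) ∧ (G.Adj w1 u ∨ G.Adj w2 u) := by
    grind
  have hB' := hB
  rw [← hrev] at hB'
  have hw1' : w1 ∈ Sᶜ := hw1
  have hl := h.not_mem_of_isAcyclic hA hB hS hw1'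
  have hr := h.reverse.not_mem_of_isAcyclic hA' hB' hS hw1'
  have hsecond := h.not_mem_and_not_reachIn_of_second hA hB hS hw1'
  have hfourth := h.reverse.not_mem_and_not_reachIn_of_second hA' hB' hS hw1'
  have hmiddle := h.not_mem_and_not_reachIn_of_middle hA hB hS hw1'
  have htwo : ∀ {s t}, (∀ p ∈ ({u, x1, x2, x3, v} : Set V), p ∈ Sᶜ ∨ p = s ∨ p = t) → _ :=
    fun hst => h.not_reachIn_or_not_reachIn hA hS hw1' hst
  have hleft := fun F => h.exists_isAcyclic_union (F := F) hB
  have hright := fun F => h.reverse.exists_isAcyclic_union (F := F) hB'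
  have hwhole := fun F => h.isAcyclic_union (F := F)
  rw [hrev] at hfourth hright
  have huP : u ∈ ({u, x1, x2, x3, v} : Set V) := by simp
  have hx1P : x1 ∈ ({u, x1, x2, x3, v} : Set V) := by simp
  have hx2P : x2 ∈ ({u, x1, x2, x3, v} : Set V) := by simp
  have hx3P : x3 ∈ ({u, x1, x2, x3, v} : Set V) := by simp
  have hvP : v ∈ ({u, x1, x2, x3, v} : Set V) := by simp
  have hPcases : ∀ s ∈ ({u, x1, x2, x3, v} : Set V), s = u ∨ s = x1 ∨ s = x2 ∨ s = x3 ∨ s = v :=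
    fun s hs => by simpa using hs
  have hd := h.nodup
  simp only [List.nodup_cons, List.mem_cons, not_or, List.not_mem_nil, not_false_eq_true,
    and_true, List.nodup_nil] at hd
  clear hrev hB hB' hA hA'
  generalize ({u, x1, x2, x3, v} : Set V) = P at *
  have hFacyc : (G.induce (Sᶜ \ insert w1 P)).IsAcyclic :=
    isAcyclic_induce_mono hS Set.sdiff_subset
  have hw1F : w1 ∉ Sᶜ \ insert w1 P := fun hz => hz.2 (.inl rfl)
  have hPF : ∀ p ∈ P, p ∉ Sᶜ \ insert w1 P := fun p hp hz => hz.2 (.inr hp)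
  obtain hn | hn | hn : (S ∩ P).ncard ≤ 1 ∨ (S ∩ P).ncard = 2 ∨ 3 ≤ (S ∩ P).ncard := by omega
  · obtain ⟨s, hs⟩ : (S ∩ P).Nonempty := by
      by_contra hne
      have hmem : ∀ p ∈ P, p ∈ Sᶜ := fun p hp hpS => hne ⟨p, hpS, hp⟩
      exact hl ⟨hmem _ hx1P, hmem _ hx2P, hmem _ hx3P, hmem _ hvP⟩
    have hmem : ∀ p ∈ P, p ≠ s → p ∈ Sᶜ := fun p hp hne hpS =>
      hne ((Set.ncard_le_one_iff (Set.toFinite _)).1 hn ⟨hpS, hp⟩ hs)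
    have key : w2 ∉ Sᶜ ∧ ¬ ReachIn G (Sᶜ \ insert w1 P) u0 v0 := by
      rcases hPcases s hs.2 with rfl | rfl | rfl | rfl | rfl
      · exact absurd ⟨hmem _ hx1P (by grind), hmem _ hx2P (by grind), hmem _ hx3P (by grind),
          hmem _ hvP (by grind)⟩ hl
      · exact hsecond (hmem _ huP (by grind)) (hmem _ hx2P (by grind)) (hmem _ hx3P (by grind))
          (hmem _ hvP (by grind))
      · exact hmiddle (hmem _ huP (by grind)) (hmem _ hx1P (by grind)) (hmem _ hx3P (by grind))
          (hmem _ hvP (by grind))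
      · obtain ⟨h1, h2⟩ := hfourth (hmem _ hvP (by grind)) (hmem _ hx2P (by grind))
          (hmem _ hx1P (by grind)) (hmem _ huP (by grind))
        exact ⟨h1, fun hz => h2 hz.symm⟩
      · exact absurd ⟨hmem _ hx3P (by grind), hmem _ hx2P (by grind), hmem _ hx1P (by grind),
          hmem _ huP (by grind)⟩ hr
    refine ⟨∅, ?_, isAcyclic_induce_mono
      (hwhole _ hFacyc hw1F (fun hz => key.1 hz.1) hPF key.2) ?_⟩
    · rw [Set.ncard_empty, zero_add, Nat.one_le_iff_ne_zero]
      exact Set.ncard_ne_zero_of_mem hs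
    · intro z hz
      simp only [Set.mem_compl_iff, Set.mem_insert_iff, Set.mem_union, Set.mem_sdiff] at hz ⊢
      grind
  · obtain ⟨s, t, -, hst⟩ := Set.ncard_eq_two.1 hn
    have hcase := htwo (s := s) (t := t) fun p hp => by
      by_cases hpS : p ∈ S
      · have hpSP : p ∈ S ∩ P := ⟨hpS, hp⟩
        rw [hst] at hpSP
        exact .inr hpSP
      · exact .inl hpS
    obtain ⟨t, ht⟩ : ∃ t, (G.induce (Sᶜ \ insert w1 P ∪ (P \ {t}))).IsAcyclic :=
      hcase.elim (hleft _ hFacyc hw1F hPF) (hright _ hFacyc hw1F hPF)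
    refine ⟨{t}, by rw [Set.ncard_singleton, hn], isAcyclic_induce_mono ht ?_⟩
    intro z hz
    simp only [Set.mem_compl_iff, Set.mem_insert_iff, Set.mem_union, Set.mem_sdiff,
      Set.mem_singleton_iff] at hz ⊢
    grind
  · obtain ⟨t, ht⟩ := hleft ((Sᶜ \ insert w1 P) \ {w2})
      (isAcyclic_induce_mono hFacyc Set.sdiff_subset) (fun hz => hw1F hz.1)
      (fun p hp hz => hPF p hp hz.1) (fun hz => hz.2.1.2 rfl)
    refine ⟨{w2, t}, ?_, isAcyclic_induce_mono ht ?_⟩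
    · have := Set.ncard_insert_le w2 {t}
      rw [Set.ncard_singleton] at this
      omega
    · intro z hz
      simp only [Set.mem_compl_iff, Set.mem_insert_iff, Set.mem_union, Set.mem_sdiff,
        Set.mem_singleton_iff] at hz ⊢
      grind

end PathConfig

/-- Correctness of Rule 15, stated for simple graphs. -/
theorem stmt_8 {V : Type*} [Fintype V]
    (G : SimpleGraph V)
    (hdeg3 : ∀ z : V, 3 ≤ (G.neighborSet z).ncard)
    (hnogamma : ¬ HasGammaConfig G)
    (u0 u x1 x2 x3 v v0 w1 w2 : V)
    (hpc : PathConfig G u0 u x1 x2 x3 v v0 w1 w2)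
    (hw2 : (G.neighborSet w2 ∩ {u, x1, x2, x3, v}).ncard ≤ 2)
    (k : ℕ) (hk : 1 ≤ k) :
    HasFVS G k ↔ HasFVS (G.induce ({w1}ᶜ : Set V)) (k - 1) := by
  rw [hasFVS_induce_compl_singleton_iff hk]
  refine ⟨fun ⟨S, hS, hacyc⟩ => ?_, fun ⟨S, _, hS⟩ => ⟨S, hS⟩⟩
  by_cases hw1 : w1 ∈ S
  · exact ⟨S, hw1, hS, hacyc⟩
  have hA := hpc.adj_or_adj hdeg3
  have hB := fun a ha b hb c hc => PathConfig.not_three_adj (a := a) (b := b) (c := c) hw2 ha hb hc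
  obtain ⟨T, hT, hTacyc⟩ := hpc.exists_isAcyclic_exchange hA hB hacyc hw1
  refine ⟨insert w1 (S \ {u, x1, x2, x3, v} ∪ T), by simp, ?_, hTacyc⟩
  have h1 := Set.ncard_insert_le w1 (S \ {u, x1, x2, x3, v} ∪ T)
  have h2 := Set.ncard_union_le (S \ {u, x1, x2, x3, v}) T
  have h3 := Set.ncard_inter_add_ncard_sdiff_eq_ncard S {u, x1, x2, x3, v}
  omega
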